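/- The number of pairs (D, E) of nonzero octonions in O × O such that DE = 0 equals (q^3 + 1)(q^4 − 1)². -/

import Mathlib

/-!  The split octonion algebra `O` over a finite field `F` of order `q`,
represented as `Fin 8 → F` with coordinates with respect to the basis
`x_1, …, x_8` (index `i : Fin 8` corresponds to `x_{i+1}`). -/

variable {F : Type*}

/-- The split octonion multiplication, determined by the table
`x_1x_5 = x_1`, `x_1x_6 = x_2`, `x_1x_7 = −x_3`, `x_1x_8 = −x_4`, `x_2x_3 = −x_1`,
`x_2x_4 = x_2`, `x_2x_7 = −x_5`, `x_2x_8 = x_6`, `x_3x_2 = x_1`, `x_3x_4 = x_3`,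
`x_3x_6 = −x_5`, `x_3x_8 = −x_7` (the sign of `x_3x_8` is forced by `x_8x_3 = x_7` and anti-commutativity of orthogonal imaginary octonions; with it `O` is the split octonion composition algebra), `x_4x_1 = x_1`, `x_4x_4 = x_4`, `x_4x_6 = x_6`,
`x_4x_7 = x_7`, `x_5x_2 = x_2`, `x_5x_3 = x_3`, `x_5x_5 = x_5`, `x_5x_8 = x_8`,
`x_6x_1 = −x_2`, `x_6x_3 = −x_4`, `x_6x_5 = x_6`, `x_6x_7 = x_8`, `x_7x_1 = x_3`,
`x_7x_2 = −x_4`, `x_7x_5 = x_7`, `x_7x_6 = −x_8`, `x_8x_1 = −x_5`, `x_8x_2 = −x_6`,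
`x_8x_3 = x_7`, `x_8x_4 = x_8`, all other products of basis elements being `0`. -/
def octMul [Field F] (a b : Fin 8 → F) : Fin 8 → F :=
  ![a 0 * b 4 - a 1 * b 2 + a 2 * b 1 + a 3 * b 0,
    a 0 * b 5 + a 1 * b 3 + a 4 * b 1 - a 5 * b 0,
    -(a 0 * b 6) + a 2 * b 3 + a 4 * b 2 + a 6 * b 0,
    -(a 0 * b 7) + a 3 * b 3 - a 5 * b 2 - a 6 * b 1,
    -(a 1 * b 6) - a 2 * b 5 + a 4 * b 4 - a 7 * b 0,
    a 1 * b 7 + a 3 * b 5 + a 5 * b 4 - a 7 * b 1,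
    -(a 2 * b 7) + a 3 * b 6 + a 6 * b 4 + a 7 * b 2,
    a 4 * b 7 + a 5 * b 6 - a 6 * b 5 + a 7 * b 3]

/-- The identity `1 = x_4 + x_5` of the octonion algebra. -/
def octOne [Field F] : Fin 8 → F := ![0, 0, 0, 1, 1, 0, 0, 0]

/-- Octonion conjugation: swaps `x_4, x_5` and negates the other basis vectors. -/
def octConj [Field F] (a : Fin 8 → F) : Fin 8 → F :=
  ![-a 0, -a 1, -a 2, a 4, a 3, -a 5, -a 6, -a 7]

/-- The trace `Tr(Σ λ_i x_i) = λ_4 + λ_5`. -/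
def octTr [Field F] (a : Fin 8 → F) : F := a 3 + a 4

/-- The norm `N(Σ λ_i x_i) = λ_1λ_8 + λ_2λ_7 + λ_3λ_6 + λ_4λ_5`. -/
def octN [Field F] (a : Fin 8 → F) : F :=
  a 0 * a 7 + a 1 * a 6 + a 2 * a 5 + a 3 * a 4

/-- The bilinear form `B(x,y) = N(x+y) − N(x) − N(y)`. -/
def octB [Field F] (a b : Fin 8 → F) : F := octN (a + b) - octN a - octN b

/-- The basis octonion `x_1`. -/
def octX1 [Field F] : Fin 8 → F := ![1, 0, 0, 0, 0, 0, 0, 0]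

/-- Left multiplication by an octonion, as a linear map. -/
def octMulLeft [Field F] (a : Fin 8 → F) : (Fin 8 → F) →ₗ[F] (Fin 8 → F) where
  toFun := octMul a
  map_add' b c := by
    ext i
    fin_cases i <;> simp [octMul] <;> ring
  map_smul' r b := by
    ext i
    fin_cases i <;> simp [octMul] <;> ring

theorem octMulLeft_apply [Field F] (a b : Fin 8 → F) : octMulLeft a b = octMul a b := rfl

theorem octMul_octConj_octMul [Field F] (a b : Fin 8 → F) :
    octMul (octConj a) (octMul a b) = octN a • b := by
  ext i
  fin_cases i <;> simp [octMul, octConj, octN] <;> ring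

theorem octConj_octConj [Field F] (a : Fin 8 → F) : octConj (octConj a) = a := by
  ext i
  fin_cases i <;> simp [octConj]

theorem octConj_ne_zero [Field F] {a : Fin 8 → F} (ha : a ≠ 0) : octConj a ≠ 0 := by
  intro h
  apply ha
  rw [← octConj_octConj a, h]
  ext i
  fin_cases i <;> simp [octConj]

/-- A zero of left multiplication by a nonzero octonion is determined by four suitable
coordinates. -/
theorem exists_coords_determine_ker [Field F] {a : Fin 8 → F} (ha : a ≠ 0) :
    ∃ s : Fin 4 → Fin 8, ∀ b, octMul a b = 0 → (∀ j, b (s j) = 0) → b = 0 := by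
  obtain ⟨i, hi⟩ := Function.ne_iff.mp ha
  refine ⟨(![![0, 1, 2, 3], ![0, 1, 4, 5], ![0, 2, 4, 6], ![1, 2, 4, 7],
    ![0, 3, 5, 6], ![1, 3, 5, 7], ![2, 3, 6, 7], ![4, 5, 6, 7]] : Fin 8 → Fin 4 → Fin 8) i,
    fun b hb hs => ?_⟩
  have h (k : Fin 8) : octMul a b k = 0 := congrFun hb k
  ext k
  fin_cases i <;> simp [octMul, Fin.forall_fin_succ] at hi hs h <;>
    fin_cases k <;> simp_all

theorem finrank_ker_octMulLeft_le [Field F] {a : Fin 8 → F} (ha : a ≠ 0) :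
    Module.finrank F (LinearMap.ker (octMulLeft a)) ≤ 4 := by
  obtain ⟨s, hs⟩ := exists_coords_determine_ker ha
  have hinj : Function.Injective
      (LinearMap.funLeft F F s ∘ₗ (LinearMap.ker (octMulLeft a)).subtype) := by
    rw [← LinearMap.ker_eq_bot, LinearMap.ker_eq_bot']
    rintro ⟨b, hb⟩ h
    exact Subtype.ext (hs b hb (congrFun h))
  simpa using LinearMap.finrank_le_finrank_of_injective hinj

theorem finrank_ker_octMulLeft [Field F] {a : Fin 8 → F} (ha : a ≠ 0) (hN : octN a = 0) :
    Module.finrank F (LinearMap.ker (octMulLeft a)) = 4 := by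
  have hle : LinearMap.range (octMulLeft a) ≤ LinearMap.ker (octMulLeft (octConj a)) := by
    rintro _ ⟨b, rfl⟩
    simp [octMulLeft_apply, octMul_octConj_octMul, hN]
  have h₁ := Submodule.finrank_mono hle
  have h₂ := LinearMap.finrank_range_add_finrank_ker (octMulLeft a)
  have h₃ := finrank_ker_octMulLeft_le ha
  have h₄ := finrank_ker_octMulLeft_le (octConj_ne_zero ha)
  simp only [Module.finrank_fin_fun] at h₂
  omega

theorem octN_eq_zero_of_octMul_eq_zero [Field F] {a b : Fin 8 → F} (hb : b ≠ 0)
    (h : octMul a b = 0) : octN a = 0 := by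
  have h' := octMul_octConj_octMul a b
  rw [h, ← octMulLeft_apply, map_zero] at h'
  exact (smul_eq_zero.mp h'.symm).resolve_right hb

theorem card_ne_zero_and [Fintype F] [Field F] (p : (Fin 8 → F) → Prop) (h0 : p 0) :
    Nat.card {b : Fin 8 → F // b ≠ 0 ∧ p b} = Nat.card {b : Fin 8 → F // p b} - 1 := by
  change Nat.card ({b | b ≠ 0 ∧ p b} : Set (Fin 8 → F)) = Nat.card ({b | p b} : Set _) - 1
  rw [Nat.card_coe_set_eq, Nat.card_coe_set_eq,
    ← Set.ncard_sdiff_singleton_of_mem (s := {b | p b}) h0]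
  congr 1
  ext b
  simp [and_comm]

theorem card_right_annihilators [Field F] [Fintype F] {a : Fin 8 → F} (ha : a ≠ 0)
    (hN : octN a = 0) :
    Nat.card {b : Fin 8 → F // b ≠ 0 ∧ octMul a b = 0} = Fintype.card F ^ 4 - 1 := by
  rw [card_ne_zero_and (fun b => octMul a b = 0) (map_zero (octMulLeft a))]
  change Nat.card (LinearMap.ker (octMulLeft a)) - 1 = _
  rw [Module.natCard_eq_pow_finrank (K := F), finrank_ker_octMulLeft ha hN,
    Nat.card_eq_fintype_card]

theorem card_dotProduct_eq_zero [Field F] [Fintype F] {u : Fin 4 → F} (hu : u ≠ 0) :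
    Nat.card {v : Fin 4 → F // u ⬝ᵥ v = 0} = Fintype.card F ^ 3 := by
  have hne : dotProductBilin F F u ≠ 0 := by
    intro h
    exact hu (dotProduct_eq_zero u fun v => LinearMap.congr_fun h v)
  have h := Module.Dual.finrank_ker_add_one_of_ne_zero (f := dotProductBilin F F u) hne
  change Nat.card (LinearMap.ker (dotProductBilin F F u)) = _
  rw [Module.natCard_eq_pow_finrank (K := F), Nat.card_eq_fintype_card]
  simp only [Module.finrank_fin_fun] at h
  congr 1
  omega

/-- Coordinates in which the octonion norm is the pairing of two vectors of length four. -/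
def octSplit (F : Type*) : (Fin 8 → F) ≃ (Fin 4 → F) × (Fin 4 → F) where
  toFun a := (![a 0, a 1, a 2, a 3], ![a 7, a 6, a 5, a 4])
  invFun p := ![p.1 0, p.1 1, p.1 2, p.1 3, p.2 3, p.2 2, p.2 1, p.2 0]
  left_inv a := by
    ext i
    fin_cases i <;> rfl
  right_inv p := by
    ext i <;> fin_cases i <;> rfl

theorem octN_eq_dotProduct [Field F] (a : Fin 8 → F) :
    octN a = (octSplit F a).1 ⬝ᵥ (octSplit F a).2 := by
  simp [octN, octSplit, dotProduct, Fin.sum_univ_four]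

theorem card_octN_eq_zero [Field F] [Fintype F] :
    Nat.card {a : Fin 8 → F // octN a = 0} =
      Fintype.card F ^ 4 + (Fintype.card F ^ 4 - 1) * Fintype.card F ^ 3 := by
  classical
  rw [Nat.card_congr ((octSplit F).subtypeEquiv
    (q := fun p => p.1 ⬝ᵥ p.2 = 0) fun a => by rw [octN_eq_dotProduct]),
    Nat.card_congr (Equiv.subtypeProdEquivSigmaSubtype fun u v : Fin 4 → F => u ⬝ᵥ v = 0),
    Nat.card_sigma, ← Finset.add_sum_erase _ _ (Finset.mem_univ 0),
    Finset.sum_congr rfl fun u hu => card_dotProduct_eq_zero (Finset.ne_of_mem_erase hu)]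
  simp [Finset.card_erase_of_mem]

theorem card_ne_zero_octN_eq_zero [Field F] [Fintype F] :
    Nat.card {a : Fin 8 → F // a ≠ 0 ∧ octN a = 0} =
      (Fintype.card F ^ 3 + 1) * (Fintype.card F ^ 4 - 1) := by
  rw [card_ne_zero_and _ (by simp [octN]), card_octN_eq_zero]
  obtain ⟨m, hm⟩ := Nat.exists_eq_add_of_le' (Nat.one_le_pow 4 _ (Fintype.card_pos (α := F)))
  rw [hm, Nat.add_sub_cancel, show m + 1 + m * Fintype.card F ^ 3 =
    (Fintype.card F ^ 3 + 1) * m + 1 by ring, Nat.add_sub_cancel]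

/-- Pairs of zero divisors, fibred over the left factor. -/
def zeroDivisorPairsEquiv [Field F] :
    {p : (Fin 8 → F) × (Fin 8 → F) // p.1 ≠ 0 ∧ p.2 ≠ 0 ∧ octMul p.1 p.2 = 0} ≃
      (a : {a : Fin 8 → F // a ≠ 0 ∧ octN a = 0}) ×
        {b : Fin 8 → F // b ≠ 0 ∧ octMul a.1 b = 0} where
  toFun p := ⟨⟨p.1.1, p.2.1, octN_eq_zero_of_octMul_eq_zero p.2.2.1 p.2.2.2⟩, p.1.2, p.2.2⟩
  invFun x := ⟨(x.1.1, x.2.1), x.1.2.1, x.2.2⟩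
  left_inv _ := rfl
  right_inv _ := rfl

/-- The number of pairs `(D, E)` of nonzero octonions with
`DE = 0` equals `(q^3 + 1)(q^4 − 1)²`. -/
theorem stmt_12 {F : Type*} [Field F] [Fintype F] :
    Nat.card {p : (Fin 8 → F) × (Fin 8 → F) //
        p.1 ≠ 0 ∧ p.2 ≠ 0 ∧ octMul p.1 p.2 = 0} =
      (Fintype.card F ^ 3 + 1) * (Fintype.card F ^ 4 - 1) ^ 2 := by
  classical
  rw [Nat.card_congr zeroDivisorPairsEquiv, Nat.card_sigma,
    Finset.sum_congr rfl fun a _ => card_right_annihilators a.2.1 a.2.2, Finset.sum_const,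
    Finset.card_univ, ← Nat.card_eq_fintype_card, card_ne_zero_octN_eq_zero, smul_eq_mul]
  ring
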